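/- For all real b > 0 and c > 0, the integral ∫₀^∞ η³(i·4x/π) · e^{-b²x} · sin(cx) dx equals c · Σ_{n≥1} χ(n) · n / ( (n²+b²)² + c² ). -/

import Mathlib

open Real

/-- Dedekind eta function on the imaginary axis: `dedekindEtaI x = η(i x)`
for real `x > 0`, with `q = e^{-2πx}`. -/
noncomputable def dedekindEtaI (x : ℝ) : ℝ :=
  Real.exp (-(π * x) / 12) * ∏' n : ℕ, (1 - Real.exp (-(2 * π * x) * (n + 1)))

noncomputable def A (b c : ℝ) : ℝ := Real.sqrt ((Real.sqrt (b ^ 4 + c ^ 2) + b ^ 2) / 2)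

noncomputable def B (b c : ℝ) : ℝ := Real.sqrt ((Real.sqrt (b ^ 4 + c ^ 2) - b ^ 2) / 2)

/-- The character χ with χ(n)=0 for even n, 1 for n ≡ 1 (mod 4), −1 for n ≡ 3 (mod 4). -/
noncomputable def chi (n : ℕ) : ℝ :=
  if n % 2 = 0 then 0 else if n % 4 = 1 then 1 else -1

open Filter Topology MeasureTheory

/-- The `q`-Pochhammer symbol `(q; q)_n = ∏_{k=1}^{n} (1 - q ^ k)`. -/
noncomputable def qPoch (q : ℝ) (n : ℕ) : ℝ := ∏ k ∈ Finset.range n, (1 - q ^ (k + 1))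

/-- The reciprocal `1 / (q; q)_k`, extended by zero to negative indices. -/
noncomputable def invQPoch (q : ℝ) (k : ℤ) : ℝ := if k < 0 then 0 else (qPoch q k.toNat)⁻¹

/-- The odd Gaussian binomial coefficient `[2n+1 choose n-j]_q`, symmetric about `j = -1/2`. -/
noncomputable def oddQBinom (q : ℝ) (n : ℕ) (j : ℤ) : ℝ :=
  qPoch q (2 * n + 1) * invQPoch q (n - j) * invQPoch q (n + 1 + j)

/-- The signed theta coefficient `(-1)^j q^{j(j+1)/2}`. -/
noncomputable def thetaCoeff (q : ℝ) (j : ℤ) : ℝ := (-1) ^ j * q ^ (j * (j + 1) / 2)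

lemma qPoch_pos {q : ℝ} (h0 : 0 < q) (h1 : q < 1) (n : ℕ) : 0 < qPoch q n :=
  Finset.prod_pos fun k _ => sub_pos.2 (pow_lt_one₀ h0.le h1 k.succ_ne_zero)

lemma qPoch_succ (q : ℝ) (n : ℕ) : qPoch q (n + 1) = qPoch q n * (1 - q ^ (n + 1)) :=
  Finset.prod_range_succ _ _

lemma qPoch_antitone {q : ℝ} (h0 : 0 < q) (h1 : q < 1) : Antitone (qPoch q) :=
  antitone_nat_of_succ_le fun n => by
    rw [qPoch_succ]
    exact mul_le_of_le_one_right (qPoch_pos h0 h1 n).le (sub_le_self _ (by positivity))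

lemma tendsto_qPoch {q : ℝ} (h0 : 0 < q) (h1 : q < 1) :
    Tendsto (qPoch q) atTop (𝓝 (∏' n : ℕ, (1 - q ^ (n + 1)))) := by
  have h : Multipliable fun n : ℕ => 1 + -q ^ (n + 1) :=
    Real.multipliable_one_add_of_summable
      ((summable_nat_add_iff 1).2 (summable_geometric_of_lt_one h0.le h1)).neg
  simp only [← sub_eq_add_neg] at h
  exact h.hasProd.tendsto_prod_nat

lemma tprod_one_sub_pow_pos {q : ℝ} (h0 : 0 < q) (h1 : q < 1) :
    0 < ∏' n : ℕ, (1 - q ^ (n + 1)) := by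
  refine lt_of_le_of_ne (ge_of_tendsto' (tendsto_qPoch h0 h1) fun n => (qPoch_pos h0 h1 n).le) ?_
  have h := tprod_one_add_ne_zero_of_summable (f := fun n : ℕ => -q ^ (n + 1))
    (fun i => by
      have : q ^ (i + 1) < 1 := pow_lt_one₀ h0.le h1 i.succ_ne_zero
      exact (by linarith : 0 < 1 + -q ^ (i + 1)).ne')
    ((summable_nat_add_iff 1).2 (summable_geometric_of_lt_one h0.le h1)).neg.norm
  simpa only [← sub_eq_add_neg] using h.symm

lemma invQPoch_sub_one {q : ℝ} (h0 : 0 < q) (h1 : q < 1) (k : ℤ) :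
    invQPoch q (k - 1) = (1 - q ^ k) * invQPoch q k := by
  rcases lt_trichotomy k 0 with hk | rfl | hk
  · simp [invQPoch, hk, show k - 1 < 0 by omega]
  · simp [invQPoch]
  · obtain ⟨m, rfl⟩ : ∃ m : ℕ, k = m + 1 := ⟨(k - 1).toNat, by omega⟩
    have h2 := (sub_pos.2 (pow_lt_one₀ h0.le h1 m.succ_ne_zero)).ne'
    have e : ((m : ℤ) + 1).toNat = m + 1 := by omega
    have e2 : q ^ ((m : ℤ) + 1) = q ^ (m + 1) := by exact_mod_cast zpow_natCast q (m + 1)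
    simp only [invQPoch, add_sub_cancel_right, e, e2, qPoch_succ, Int.toNat_natCast,
      if_neg (show ¬ (m : ℤ) < 0 by omega), if_neg (show ¬ (m : ℤ) + 1 < 0 by omega)]
    have := (qPoch_pos h0 h1 m).ne'
    field_simp

lemma invQPoch_nonneg {q : ℝ} (h0 : 0 < q) (h1 : q < 1) (k : ℤ) : 0 ≤ invQPoch q k := by
  unfold invQPoch
  split_ifs
  exacts [le_rfl, (inv_pos.2 (qPoch_pos h0 h1 _)).le]

lemma invQPoch_le {q : ℝ} (h0 : 0 < q) (h1 : q < 1) (k : ℤ) :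
    invQPoch q k ≤ (∏' n : ℕ, (1 - q ^ (n + 1)))⁻¹ := by
  have hP := tprod_one_sub_pow_pos h0 h1
  unfold invQPoch
  split_ifs
  · positivity
  · exact inv_anti₀ hP ((qPoch_antitone h0 h1).le_of_tendsto (tendsto_qPoch h0 h1) _)

lemma tendsto_invQPoch {q : ℝ} (h0 : 0 < q) (h1 : q < 1) :
    Tendsto (invQPoch q) atTop (𝓝 (∏' n : ℕ, (1 - q ^ (n + 1)))⁻¹) := by
  have h : Tendsto (fun k : ℤ => (qPoch q k.toNat)⁻¹) atTop
      (𝓝 (∏' n : ℕ, (1 - q ^ (n + 1)))⁻¹) :=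
    ((tendsto_qPoch h0 h1).inv₀ (tprod_one_sub_pow_pos h0 h1).ne').comp
      (tendsto_atTop.2 fun b => by
        filter_upwards [eventually_ge_atTop (b : ℤ)] with k hk
        omega)
  refine h.congr' ?_
  filter_upwards [eventually_ge_atTop 0] with k hk
  rw [invQPoch, if_neg (not_lt.2 hk)]

lemma oddQBinom_succ {q : ℝ} (h0 : 0 < q) (h1 : q < 1) (n : ℕ) (j : ℤ) :
    oddQBinom q (n + 1) j = (1 + (q ^ (n + 1)) ^ 2) * oddQBinom q n j
      + q ^ (n + 1) * (q ^ (-j) * oddQBinom q n (j - 1)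
        + q ^ (j + 1) * oddQBinom q n (j + 1)) := by
  have hq := h0.ne'
  have a1 := invQPoch_sub_one h0 h1 (n + 1 - j)
  have a2 := invQPoch_sub_one h0 h1 (n - j)
  have b1 := invQPoch_sub_one h0 h1 (n + 2 + j)
  have b2 := invQPoch_sub_one h0 h1 (n + 1 + j)
  have hX : q ^ ((n : ℤ) + 1 - j) = q ^ (n + 1) * q ^ (-j) := by
    rw [← zpow_natCast, ← zpow_add₀ hq]; congr 1
  have hX' : q ^ ((n : ℤ) - j) = q ^ n * q ^ (-j) := by
    rw [← zpow_natCast, ← zpow_add₀ hq, sub_eq_add_neg]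
  have hY : q ^ ((n : ℤ) + 2 + j) = q ^ (n + 1) * q ^ (j + 1) := by
    rw [← zpow_natCast, ← zpow_add₀ hq]; congr 1; push_cast; ring
  have hY' : q ^ ((n : ℤ) + 1 + j) = q ^ n * q ^ (j + 1) := by
    rw [← zpow_natCast, ← zpow_add₀ hq]; congr 1; ring
  have hUV : q ^ (-j) * q ^ (j + 1) = q := by
    rw [← zpow_add₀ hq]; simp
  rw [show (n : ℤ) + 1 - j - 1 = n - j by ring, hX] at a1
  rw [a1, hX', show (n : ℤ) - j - 1 = n - (j + 1) by ring] at a2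
  rw [show (n : ℤ) + 2 + j - 1 = n + 1 + j by ring, hY] at b1
  rw [b1, hY', show (n : ℤ) + 1 + j - 1 = n + 1 + (j - 1) by ring] at b2
  simp only [oddQBinom]
  rw [a1, a2, b1, b2, show (n : ℤ) - (j - 1) = n + 1 - j by ring,
    show (n : ℤ) + 1 + (j + 1) = n + 2 + j by ring,
    show ((n + 1 : ℕ) : ℤ) - j = n + 1 - j by push_cast; ring,
    show ((n + 1 : ℕ) : ℤ) + 1 + j = n + 2 + j by push_cast; ring,
    show 2 * (n + 1) + 1 = 2 * n + 1 + 1 + 1 by ring, qPoch_succ, qPoch_succ,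
    show q ^ (2 * n + 1 + 1 + 1) = q ^ n * q ^ n * q * q * q by ring,
    show q ^ (2 * n + 1 + 1) = q ^ n * q ^ n * q * q by ring, pow_succ q n]
  generalize q ^ (-j) = U at *
  generalize q ^ (j + 1) = V at *
  generalize q ^ n = N at *
  generalize invQPoch q (n + 1 - j) = a
  generalize invQPoch q (n + 2 + j) = b
  subst hUV
  ring

lemma oddQBinom_eq_zero {q : ℝ} {n : ℕ} {j : ℤ} (hj : j ∉ Finset.Icc (-(n : ℤ) - 1) n) :
    oddQBinom q n j = 0 := by
  simp only [Finset.mem_Icc, not_and_or, not_le] at hj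
  rcases hj with hj | hj
  · simp [oddQBinom, invQPoch, show (n : ℤ) + 1 + j < 0 by omega]
  · simp [oddQBinom, invQPoch, show (n : ℤ) - j < 0 by omega]

lemma thetaCoeff_add_one {q : ℝ} (h0 : 0 < q) (j : ℤ) :
    thetaCoeff q (j + 1) = -(q ^ (j + 1) * thetaCoeff q j) := by
  have e : (j + 1) * (j + 1 + 1) / 2 = j * (j + 1) / 2 + (j + 1) := by
    rw [show (j + 1) * (j + 1 + 1) = j * (j + 1) + (j + 1) * 2 by ring,
      Int.add_mul_ediv_right _ _ two_ne_zero]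
  rw [thetaCoeff, thetaCoeff, e, zpow_add₀ h0.ne' _ (j + 1), zpow_add_one₀ (by norm_num)]
  ring

lemma thetaCoeff_natCast (q : ℝ) (n : ℕ) :
    thetaCoeff q n = (-1) ^ n * q ^ (n * (n + 1) / 2) := by
  rw [thetaCoeff, zpow_natCast]
  congr 1

lemma thetaCoeff_neg_add_one (q : ℝ) (j : ℤ) : thetaCoeff q (-(j + 1)) = -thetaCoeff q j := by
  rw [thetaCoeff, thetaCoeff, show -(j + 1) * (-(j + 1) + 1) = j * (j + 1) by ring,
    zpow_neg, zpow_add_one₀ (by norm_num)]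
  have : ((-1 : ℝ) ^ j)⁻¹ = (-1) ^ j := by rw [← inv_zpow]; norm_num
  rw [mul_inv, this]
  norm_num

/-- A finite form of Jacobi's identity for the cube of the Euler product. -/
lemma tsum_oddQBinom {q : ℝ} (h0 : 0 < q) (h1 : q < 1) (n : ℕ) :
    ∑' j : ℤ, (2 * (j : ℝ) + 1) * thetaCoeff q j * oddQBinom q n j = 2 * qPoch q n ^ 2 := by
  induction n with
  | zero =>
    rw [tsum_eq_sum (s := {-1, 0})]
    · have : 1 - q ≠ 0 := by linarith
      simp [oddQBinom, invQPoch, thetaCoeff, qPoch, this]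
    · intro j hj
      rw [oddQBinom_eq_zero, mul_zero]
      simp at hj ⊢
      omega
  | succ n ih =>
    set f : ℤ → ℝ := fun j => thetaCoeff q j * oddQBinom q n j with hf
    have hs (g : ℤ → ℝ) : Summable fun j => g j * f j :=
      summable_of_ne_finset_zero (s := Finset.Icc (-(n : ℤ) - 1) n) fun j hj => by
        simp [hf, oddQBinom_eq_zero hj]
    have hsub : HasSum (fun j : ℤ => (2 * (j : ℝ) + 1) * f (j - 1))
        (∑' j : ℤ, (2 * (j : ℝ) + 3) * f j) := by
      rw [← (Equiv.addRight (1 : ℤ)).hasSum_iff]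
      convert! (hs fun j => 2 * (j : ℝ) + 3).hasSum using 2 with j
      simp only [Function.comp_apply, Equiv.coe_addRight, add_sub_cancel_right]
      push_cast
      ring
    have hadd : HasSum (fun j : ℤ => (2 * (j : ℝ) + 1) * f (j + 1))
        (∑' j : ℤ, (2 * (j : ℝ) - 1) * f j) := by
      rw [← (Equiv.subRight (1 : ℤ)).hasSum_iff]
      convert! (hs fun j => 2 * (j : ℝ) - 1).hasSum using 2 with j
      simp only [Function.comp_apply, Equiv.subRight_apply, sub_add_cancel]
      push_cast
      ring
    have hrec (j : ℤ) : (2 * (j : ℝ) + 1) * thetaCoeff q j * oddQBinom q (n + 1) j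
        = (1 + (q ^ (n + 1)) ^ 2) * ((2 * (j : ℝ) + 1) * f j)
          - q ^ (n + 1) * ((2 * (j : ℝ) + 1) * f (j - 1) + (2 * (j : ℝ) + 1) * f (j + 1)) := by
      have t1 := thetaCoeff_add_one h0 j
      have t2 := thetaCoeff_add_one h0 (j - 1)
      rw [sub_add_cancel] at t2
      have t3 : q ^ (-j) * thetaCoeff q j = -thetaCoeff q (j - 1) := by
        rw [t2, zpow_neg]
        have := zpow_ne_zero j h0.ne'
        field_simp
      rw [oddQBinom_succ h0 h1]
      simp only [hf, t1]
      linear_combination (2 * (j : ℝ) + 1) * q ^ (n + 1) * oddQBinom q n (j - 1) * t3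
    have hS : ∑' j : ℤ, (2 * (j : ℝ) + 1) * f j = 2 * qPoch q n ^ 2 := by
      rw [← ih]
      exact tsum_congr fun j => by simp only [hf]; ring
    have h3 : ∑' j : ℤ, (2 * (j : ℝ) + 3) * f j + ∑' j : ℤ, (2 * (j : ℝ) - 1) * f j
        = 2 * ∑' j : ℤ, (2 * (j : ℝ) + 1) * f j := by
      rw [← (hs fun j => 2 * (j : ℝ) + 3).tsum_add (hs fun j => 2 * (j : ℝ) - 1), ← tsum_mul_left]
      exact tsum_congr fun j => by ring
    have := (((hs fun j => 2 * (j : ℝ) + 1).hasSum.mul_left (1 + (q ^ (n + 1)) ^ 2)).sub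
      ((hsub.add hadd).mul_left (q ^ (n + 1)))).tsum_eq
    rw [tsum_congr hrec, this, h3, hS, qPoch_succ]
    ring

lemma summable_jacobi {q : ℝ} (h0 : 0 < q) (h1 : q < 1) :
    Summable fun n : ℕ => (2 * (n : ℝ) + 1) * q ^ (n * (n + 1) / 2) := by
  have hq : ‖q‖ < 1 := by rwa [Real.norm_of_nonneg h0.le]
  refine Summable.of_nonneg_of_le (fun n => by positivity) (fun n => ?_)
    (((summable_pow_mul_geometric_of_norm_lt_one 1 hq).mul_left 2).add
      (summable_geometric_of_norm_lt_one hq))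
  have h : n ≤ n * (n + 1) / 2 := by
    rw [Nat.le_div_iff_mul_le two_pos]
    rcases n with _ | n
    · simp
    · gcongr; omega
  calc (2 * (n : ℝ) + 1) * q ^ (n * (n + 1) / 2) ≤ (2 * (n : ℝ) + 1) * q ^ n := by
        gcongr ?_ * ?_
        exact pow_le_pow_of_le_one h0.le h1.le h
    _ = _ := by ring

/-- **Jacobi's identity** `∏ (1 - q^n)^3 = ∑ (-1)^n (2n+1) q^{n(n+1)/2}`. -/
theorem jacobi_euler_cube {q : ℝ} (h0 : 0 < q) (h1 : q < 1) :
    (∏' n : ℕ, (1 - q ^ (n + 1))) ^ 3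
      = ∑' n : ℕ, (-1) ^ n * (2 * (n : ℝ) + 1) * q ^ (n * (n + 1) / 2) := by
  set P := ∏' n : ℕ, (1 - q ^ (n + 1)) with hPdef
  have hP : 0 < P := tprod_one_sub_pow_pos h0 h1
  have hlim := tendsto_qPoch h0 h1
  set g : ℤ → ℝ := fun j => (2 * (j : ℝ) + 1) * thetaCoeff q j with hg
  have hnat (n : ℕ) : g n = (-1) ^ n * (2 * (n : ℝ) + 1) * q ^ (n * (n + 1) / 2) := by
    simp only [hg, thetaCoeff_natCast, Int.cast_natCast]
    ring
  have hneg (n : ℕ) : g (-(n + 1)) = g n := by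
    simp only [hg, thetaCoeff_neg_add_one]
    push_cast
    ring
  have hgs : Summable fun n : ℕ => g n := by
    refine Summable.of_norm ((summable_jacobi h0 h1).congr fun n => ?_)
    rw [hnat, norm_mul, norm_mul, norm_pow, norm_neg, norm_one, one_pow, one_mul,
      Real.norm_of_nonneg (by positivity), Real.norm_of_nonneg (by positivity)]
  have hgs' : Summable fun n : ℕ => g (-(n + 1)) := hgs.congr fun n => (hneg n).symm
  have hgZ : Summable g := hgs.of_nat_of_neg_add_one hgs'
  have hsum : ∑' j, g j = 2 * ∑' n : ℕ, g n := by
    rw [tsum_of_nat_of_neg_add_one hgs hgs', tsum_congr hneg, two_mul]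
  have hT : Tendsto (fun n : ℕ => ∑' j : ℤ, g j * oddQBinom q n j) atTop
      (𝓝 (∑' j : ℤ, g j * P⁻¹)) := by
    refine tendsto_tsum_of_dominated_convergence (bound := fun j => ‖g j‖ * (P⁻¹ * P⁻¹))
      (hgZ.norm.mul_right _) (fun j => ?_) (.of_forall fun n j => ?_)
    · have c1 : Tendsto (fun n : ℕ => (n : ℤ) - j) atTop atTop :=
        tendsto_atTop_add_const_right _ (-j) tendsto_natCast_atTop_atTop
      have c2 : Tendsto (fun n : ℕ => (n : ℤ) + 1 + j) atTop atTop :=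
        tendsto_atTop_add_const_right _ j
          (tendsto_atTop_add_const_right _ 1 tendsto_natCast_atTop_atTop)
      have c3 : Tendsto (fun n : ℕ => 2 * n + 1) atTop atTop :=
        tendsto_atTop_mono (fun n => (by omega : n ≤ 2 * n + 1)) tendsto_id
      have := (((hlim.comp c3).mul ((tendsto_invQPoch h0 h1).comp c1)).mul
        ((tendsto_invQPoch h0 h1).comp c2)).const_mul (g j)
      rw [← hPdef, mul_inv_cancel₀ hP.ne', one_mul] at this
      exact this
    · have b0 : qPoch q (2 * n + 1) ≤ 1 := by
        simpa [qPoch] using qPoch_antitone h0 h1 (Nat.zero_le (2 * n + 1))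
      have i1 := invQPoch_nonneg h0 h1 (n - j)
      have i2 := invQPoch_nonneg h0 h1 (n + 1 + j)
      have i0 := (qPoch_pos h0 h1 (2 * n + 1)).le
      rw [norm_mul, oddQBinom,
        Real.norm_of_nonneg (mul_nonneg (mul_nonneg i0 i1) i2)]
      refine mul_le_mul_of_nonneg_left (mul_le_mul ?_ ?_ i2 (by positivity)) (norm_nonneg _)
      · calc _ ≤ 1 * invQPoch q (n - j) := by gcongr
          _ ≤ P⁻¹ := by rw [one_mul]; exact invQPoch_le h0 h1 _
      · exact invQPoch_le h0 h1 _
  have hT' := (hlim.pow 2).const_mul 2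
  have hu := tendsto_nhds_unique (hT.congr fun n => tsum_oddQBinom h0 h1 n) hT'
  rw [tsum_mul_right, hsum, ← hPdef] at hu
  rw [← tsum_congr hnat]
  field_simp at hu
  linear_combination -hu

lemma dedekindEtaI_cube {x : ℝ} (hx : 0 < x) :
    dedekindEtaI (4 * x / π) ^ 3
      = ∑' k : ℕ, (-1) ^ k * (2 * (k : ℝ) + 1) * Real.exp (-((2 * k + 1) ^ 2) * x) := by
  have hpi := Real.pi_ne_zero
  have hq : Real.exp (-8 * x) < 1 := Real.exp_zero ▸ Real.exp_lt_exp.2 (by linarith)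
  have hprod : ∏' n : ℕ, (1 - Real.exp (-(2 * π * (4 * x / π)) * (n + 1)))
      = ∏' n : ℕ, (1 - Real.exp (-8 * x) ^ (n + 1)) := by
    refine tprod_congr fun n => ?_
    rw [← Real.exp_nat_mul]
    congr 2
    push_cast
    field_simp
    ring
  rw [dedekindEtaI, hprod, mul_pow, jacobi_euler_cube (Real.exp_pos _) hq, ← Real.exp_nat_mul,
    ← tsum_mul_left]
  refine tsum_congr fun k => ?_
  have hk : ((k * (k + 1) / 2 : ℕ) : ℝ) = (k : ℝ) * (k + 1) / 2 := by
    rw [Nat.cast_div (Nat.even_mul_succ_self k).two_dvd (by norm_num)]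
    push_cast
    ring
  rw [← Real.exp_nat_mul, hk, mul_left_comm, ← Real.exp_add]
  congr 2
  push_cast
  field_simp
  ring

lemma integrableOn_exp_neg_mul_sin {a : ℝ} (ha : 0 < a) (c : ℝ) :
    IntegrableOn (fun x : ℝ => Real.exp (-a * x) * Real.sin (c * x)) (Set.Ioi 0) := by
  refine (integrableOn_exp_mul_Ioi (neg_lt_zero.2 ha) 0).mul_bdd (c := 1) ?_ ?_
  · exact (by fun_prop : Continuous fun x : ℝ => Real.sin (c * x)).aestronglyMeasurable
  · exact .of_forall fun x => Real.abs_sin_le_one _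

lemma integral_exp_neg_mul_sin {a : ℝ} (ha : 0 < a) (c : ℝ) :
    ∫ x in Set.Ioi (0 : ℝ), Real.exp (-a * x) * Real.sin (c * x) = c / (a ^ 2 + c ^ 2) := by
  have hre : (⟨-a, c⟩ : ℂ).re < 0 := neg_lt_zero.2 ha
  have h := congrArg Complex.im (integral_exp_mul_complex_Ioi hre 0)
  have h2 := integral_im (integrableOn_exp_mul_complex_Ioi hre 0)
  simp only [RCLike.im_to_complex] at h2
  rw [← h2] at h
  simp only [Complex.exp_im, Complex.mul_re, Complex.mul_im, Complex.ofReal_re,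
    Complex.ofReal_im, mul_zero, sub_zero, zero_add] at h
  rw [h]
  simp [Complex.div_im, Complex.normSq_apply]
  ring

lemma integral_norm_exp_neg_mul_sin_le {a : ℝ} (ha : 0 < a) {c : ℝ} (hc : 0 ≤ c) :
    ∫ x in Set.Ioi (0 : ℝ), ‖Real.exp (-a * x) * Real.sin (c * x)‖ ≤ c / a ^ 2 := by
  have hI := integrableOn_rpow_mul_exp_neg_mul_rpow (p := 1) (s := 1) (by norm_num) one_pos ha
  have hE := Real.integral_rpow_mul_exp_neg_mul_Ioi (a := 2) two_pos ha
  have hE' : ∫ x in Set.Ioi (0 : ℝ), x * Real.exp (-a * x) = 1 / a ^ 2 := by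
    have e : (2 : ℝ) - 1 = 1 := by norm_num
    simpa [e, Real.Gamma_two, neg_mul] using hE
  simp only [Real.rpow_one] at hI
  calc _ ≤ ∫ x in Set.Ioi (0 : ℝ), c * (x * Real.exp (-a * x)) := by
        refine setIntegral_mono_on (integrableOn_exp_neg_mul_sin ha c).norm (hI.const_mul c)
          measurableSet_Ioi fun x hx => ?_
        have hx : 0 < x := hx
        rw [norm_mul, Real.norm_of_nonneg (Real.exp_pos _).le, Real.norm_eq_abs]
        have : |Real.sin (c * x)| ≤ c * x :=
          Real.abs_sin_le_abs.trans_eq (abs_of_nonneg (by positivity))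
        calc _ ≤ Real.exp (-a * x) * (c * x) := by gcongr
          _ = _ := by ring
    _ = _ := by rw [integral_const_mul, hE']; ring

lemma chi_odd (k : ℕ) : chi (2 * k + 1) = (-1) ^ k := by
  rcases Nat.even_or_odd' k with ⟨m, rfl | rfl⟩
  · simp [chi, show (2 * (2 * m) + 1) % 2 = 1 by omega, show (2 * (2 * m) + 1) % 4 = 1 by omega]
  · simp [chi, pow_succ, show (2 * (2 * m + 1) + 1) % 2 = 1 by omega,
      show (2 * (2 * m + 1) + 1) % 4 = 3 by omega]

/-- Sums against `chi` are alternating sums over the odd integers. -/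
lemma tsum_chi_mul (g : ℕ → ℝ) :
    ∑' n : ℕ, chi (n + 1) * g (n + 1) = ∑' k : ℕ, (-1) ^ k * g (2 * k + 1) := by
  rw [← (mul_right_injective₀ (two_ne_zero (α := ℕ))).tsum_eq]
  · exact tsum_congr fun k => by rw [chi_odd]
  · intro n hn
    by_contra h
    refine hn ?_
    have hodd : (n + 1) % 2 = 0 := by
      by_contra h'
      exact h ⟨n / 2, by simp only; omega⟩
    simp [chi, hodd]

theorem eta3_sin_series (b c : ℝ) (hb : 0 < b) (hc : 0 < c) :
    ∫ x in Set.Ioi (0 : ℝ),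
        (dedekindEtaI (4 * x / π)) ^ 3 * Real.exp (-(b ^ 2) * x) * Real.sin (c * x)
      = c * ∑' n : ℕ, chi (n + 1) * ((n : ℝ) + 1) /
          ((((n : ℝ) + 1) ^ 2 + b ^ 2) ^ 2 + c ^ 2) := by
  set a : ℕ → ℝ := fun k => (2 * (k : ℝ) + 1) ^ 2 + b ^ 2 with ha
  have hapos (k : ℕ) : 0 < a k := by positivity
  set F : ℕ → ℝ → ℝ := fun k x =>
    (-1) ^ k * (2 * (k : ℝ) + 1) * (Real.exp (-a k * x) * Real.sin (c * x)) with hF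
  have hint (k : ℕ) : IntegrableOn (F k) (Set.Ioi 0) :=
    (integrableOn_exp_neg_mul_sin (hapos k) c).const_mul _
  have hnorm : Summable fun k => ∫ x in Set.Ioi (0 : ℝ), ‖F k x‖ := by
    have hs : Summable fun k : ℕ => c * (1 / ((k + 1 : ℕ) : ℝ) ^ 2) :=
      ((summable_nat_add_iff 1).2 (Real.summable_one_div_nat_pow.2 one_lt_two)).mul_left c
    refine Summable.of_nonneg_of_le (fun k => integral_nonneg fun x => norm_nonneg _)
      (fun k => ?_) hs
    have hk : (0 : ℝ) ≤ k := k.cast_nonneg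
    have h1 : ∫ x in Set.Ioi (0 : ℝ), ‖F k x‖ = (2 * (k : ℝ) + 1) *
        ∫ x in Set.Ioi (0 : ℝ), ‖Real.exp (-a k * x) * Real.sin (c * x)‖ := by
      rw [← integral_const_mul]
      refine integral_congr_ae (.of_forall fun x => ?_)
      simp only [hF]
      rw [norm_mul, norm_mul, norm_pow, norm_neg, norm_one, one_pow, one_mul,
        Real.norm_of_nonneg (by positivity : (0 : ℝ) ≤ 2 * k + 1)]
    have h2 : (2 * (k : ℝ) + 1) ^ 2 ≤ a k := le_add_of_nonneg_right (sq_nonneg b)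
    calc _ ≤ (2 * (k : ℝ) + 1) * (c / a k ^ 2) := by
          rw [h1]
          gcongr
          exact integral_norm_exp_neg_mul_sin_le (hapos k) hc.le
      _ ≤ (2 * (k : ℝ) + 1) * (c / ((2 * (k : ℝ) + 1) ^ 2) ^ 2) := by gcongr
      _ = c * (1 / (2 * (k : ℝ) + 1) ^ 3) := by field_simp
      _ ≤ c * (1 / (2 * (k : ℝ) + 1) ^ 2) := by
          gcongr ?_ * (1 / ?_)
          exact pow_le_pow_right₀ (by linarith) (by norm_num)
      _ ≤ _ := by
          push_cast
          gcongr
          linarith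
  have hsum := (hasSum_integral_of_summable_integral_norm hint hnorm).tsum_eq
  have hL : ∫ x in Set.Ioi (0 : ℝ),
      (dedekindEtaI (4 * x / π)) ^ 3 * Real.exp (-(b ^ 2) * x) * Real.sin (c * x)
      = ∫ x in Set.Ioi (0 : ℝ), ∑' k, F k x := by
    refine setIntegral_congr_fun measurableSet_Ioi fun x hx => ?_
    simp only [dedekindEtaI_cube hx, ← tsum_mul_right]
    refine tsum_congr fun k => ?_
    simp only [hF, ha]
    rw [show -((2 * (k : ℝ) + 1) ^ 2 + b ^ 2) * x
      = -((2 * k + 1) ^ 2) * x + -(b ^ 2) * x by ring, Real.exp_add]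
    ring
  have hR := tsum_chi_mul fun m => (m : ℝ) / (((m : ℝ) ^ 2 + b ^ 2) ^ 2 + c ^ 2)
  push_cast at hR
  rw [hL, ← hsum]
  simp only [mul_div_assoc]
  rw [hR, ← tsum_mul_left]
  refine tsum_congr fun k => ?_
  simp only [hF]
  rw [integral_const_mul, integral_exp_neg_mul_sin (hapos k)]
  ring
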